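/- arXiv:2212.00891 — 2 statements merged into one kernel-verified Lean document; each statement's English description precedes it below -/
import Mathlib

section
/- Let f : ℕ → ℕ be a non-decreasing function, let c, p be natural numbers with c ≥ 1 and p ≥ 1, and let d be a positive real number. Suppose that for every i ∈ ℕ, f(⌊(c + i·p)/d⌋) ≥ c + i·p. Then for every natural number n with n > ⌊c/d⌋, we have (f(n) : ℝ) ≥ d·n/(p + 1). In particular f(n) ∈ Ω(n). -/
open Asymptotics Filter

/-- Growth argument from Lemma 4: if a non-decreasing `f : ℕ → ℕ` satisfies
`f(⌊(c + i·p)/d⌋) ≥ c + i·p` for all `i`, where `c, p ≥ 1` and `d > 0`, then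
`f(n) ≥ d·n/(p+1)` for all `n > ⌊c/d⌋`; in particular `f(n) ∈ Ω(n)`. -/
theorem envelope_at_least_linear
    (f : ℕ → ℕ) (hmono : Monotone f)
    (c p : ℕ) (hc : 1 ≤ c) (hp : 1 ≤ p)
    (d : ℝ) (hd : 0 < d)
    (h : ∀ i : ℕ, (c + i * p : ℕ) ≤ f (Nat.floor ((c + i * p : ℕ) / d)) ) :
    (∀ n : ℕ, Nat.floor ((c : ℝ) / d) < n → d * n / (p + 1) ≤ (f n : ℝ)) ∧
    ((fun n : ℕ => (n : ℝ)) =O[atTop] fun n : ℕ => (f n : ℝ)) := by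
  have key : ∀ n : ℕ, Nat.floor ((c : ℝ) / d) < n → d * n / (p + 1) ≤ (f n : ℝ) := by
    intro n hn
    have h1 : (c : ℝ) / d < n := (Nat.floor_lt (by positivity)).1 hn
    have h2 : (c : ℝ) < n * d := (div_lt_iff₀ hd).1 h1
    have hp' : (0 : ℝ) < p := by exact_mod_cast hp
    have hc' : (1 : ℝ) ≤ c := by exact_mod_cast hc
    have hx : 0 ≤ ((n : ℝ) * d - c) / p := div_nonneg (by linarith) hp'.le
    obtain ⟨i, hi⟩ : ∃ i, i = Nat.floor (((n : ℝ) * d - c) / p) := ⟨_, rfl⟩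
    have h3 : (i : ℝ) * p ≤ n * d - c := by
      rw [← le_div_iff₀ hp', hi]
      exact Nat.floor_le hx
    have h4 : (n : ℝ) * d - c < (i + 1) * p := by
      rw [← div_lt_iff₀ hp', hi]
      exact Nat.lt_floor_add_one _
    have h5 : Nat.floor (((c + i * p : ℕ) : ℝ) / d) ≤ n := by
      apply Nat.floor_le_of_le
      rw [div_le_iff₀ hd]
      push_cast
      linarith
    have h6 : ((c + i * p : ℕ) : ℝ) ≤ f n := by
      exact_mod_cast (h i).trans (hmono h5)
    push_cast at h6
    have h7 : (0 : ℝ) ≤ i * p := by positivity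
    have h8 : (1 : ℝ) ≤ f n := by linarith
    rw [div_le_iff₀ (by positivity)]
    nlinarith
  refine ⟨key, ?_⟩
  apply IsBigO.of_bound (((p : ℝ) + 1) / d)
  filter_upwards [eventually_gt_atTop (Nat.floor ((c : ℝ) / d))] with n hn
  have h1 := key n hn
  rw [div_le_iff₀ (by positivity)] at h1
  rw [Real.norm_natCast, Real.norm_natCast, div_mul_eq_mul_div, le_div_iff₀ hd]
  linarith
end

section
/- Let L be the language over the alphabet {a, b} of all words a^1 b a^2 b ⋯ a^r b for r ≥ 0, and let L₀ = pref(L). For every word w ∈ L₀ of length n, letting r denote the number of occurrences of the letter b in w, we have r(r+3)/2 ≤ n ≤ r(r+3)/2 + r + 1. Consequently, over the reals, √(2n) − 3 ≤ r ≤ √(2n). -/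
/-- The word `a^1 b a^2 b ⋯ a^r b` over the alphabet `Fin 2` (with `a = 0`, `b = 1`). -/
def stairWord (r : ℕ) : List (Fin 2) :=
  (List.range r).flatMap fun i => List.replicate (i + 1) 0 ++ [1]

theorem stair_succ (r : ℕ) : stairWord (r+1) = stairWord r ++ (List.replicate (r + 1) 0 ++ [1]) := by
  simp [stairWord, List.range_succ]

theorem stair_full (r : ℕ) : (stairWord r).count 1 = r ∧ 2 * (stairWord r).length = r * (r + 3) := by
  induction r with
  | zero => simp [stairWord]
  | succ r ih =>
    obtain ⟨h1, h2⟩ := ih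
    rw [stair_succ]
    simp only [List.count_append, List.length_append, h1, List.count_replicate, List.length_replicate]
    constructor
    · simp
    · simp only [List.length_singleton]; nlinarith

theorem stair_aux (r : ℕ) (w : List (Fin 2)) (h : w <+: stairWord r) :
    w.count 1 * (w.count 1 + 3) ≤ 2 * w.length ∧
    2 * w.length ≤ w.count 1 * (w.count 1 + 3) + 2 * w.count 1 + 2 := by
  induction r with
  | zero =>
    have : w = [] := by simpa [stairWord] using h
    subst this; simp
  | succ r ih =>
    have hs : stairWord r <+: stairWord (r+1) := by rw [stair_succ]; exact List.prefix_append _ _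
    rcases List.prefix_or_prefix_of_prefix h hs with h' | h'
    · exact ih h'
    · obtain ⟨t, rfl⟩ := h'
      rw [stair_succ, List.prefix_append_right_inj, List.prefix_concat_iff] at h
      obtain ⟨h1, h2⟩ := stair_full r
      rcases h with rfl | h
      · rw [← stair_succ]
        obtain ⟨h1, h2⟩ := stair_full (r+1)
        rw [h1, h2]; omega
      · have hl := h.length_le
        have hc : t.count 1 = 0 := by
          have := h.sublist.count_le 1
          simpa [List.count_replicate] using this
        simp only [List.length_replicate] at hl
        rw [List.count_append, List.length_append, h1, hc]
        constructor <;> simp only [Nat.add_zero] <;> omega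

/-- For every prefix `w` of a word of `L = { a^1 b a^2 b ⋯ a^r b : r ≥ 0 }`,
with `n = |w|` and `r = |w|_b`, we have `r(r+3)/2 ≤ n ≤ r(r+3)/2 + r + 1`,
and consequently `√(2n) − 3 ≤ r ≤ √(2n)` over the reals. -/
theorem stair_prefix_block_count_bounds
    (w : List (Fin 2)) (hw : ∃ v, (∃ r : ℕ, v = stairWord r) ∧ w <+: v) :
    (w.count 1 * (w.count 1 + 3)) / 2 ≤ w.length ∧
    w.length ≤ (w.count 1 * (w.count 1 + 3)) / 2 + w.count 1 + 1 ∧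
    Real.sqrt (2 * w.length) - 3 ≤ (w.count 1 : ℝ) ∧
    (w.count 1 : ℝ) ≤ Real.sqrt (2 * w.length) := by
  obtain ⟨v, ⟨r, rfl⟩, h⟩ := hw
  obtain ⟨h1, h2⟩ := stair_aux r w h
  generalize w.count 1 = c at *
  generalize w.length = n at *
  have h1' : (c : ℝ) * (c + 3) ≤ 2 * n := by exact_mod_cast h1
  have h2' : (2 * n : ℝ) ≤ c * (c + 3) + 2 * c + 2 := by exact_mod_cast h2
  have hc : (0 : ℝ) ≤ c := Nat.cast_nonneg c
  have he : Even (c * (c + 3)) := by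
    rcases Nat.even_or_odd c with h | h
    · exact h.mul_right _
    · exact (h.add_odd (by decide)).mul_left _
  obtain ⟨k, hk⟩ := he
  refine ⟨by omega, by omega, ?_, ?_⟩
  · rw [sub_le_iff_le_add]
    apply Real.sqrt_le_iff.2
    constructor <;> nlinarith
  · apply Real.le_sqrt_of_sq_le
    nlinarith
end
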